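/- arXiv:1802.00630 — 2 statements merged into one kernel-verified Lean document; each statement's English description precedes it below -/
import Mathlib

section
/- Let W be a symmetric positive definite real k×k matrix and let S be a symmetric real k×k matrix. Then 2‖W⁻¹S‖_F² ≤ ‖W⁻¹S + S W⁻¹‖_F², where ‖·‖_F denotes the Frobenius norm. Consequently, any bound on the Frobenius norm of the anticommutator W⁻¹S + SW⁻¹ yields a bound on ‖W⁻¹S‖_F. -/
open Matrix

/-- The Frobenius norm of a real square matrix, `‖A‖_F = (tr(A Aᵀ))^{1/2}`. -/
noncomputable def frobNorm {k : ℕ} (A : Matrix (Fin k) (Fin k) ℝ) : ℝ :=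
  Real.sqrt ((A * Aᵀ).trace)

theorem trace_mul_transpose_self_nonneg {k : ℕ} (A : Matrix (Fin k) (Fin k) ℝ) :
    0 ≤ (A * Aᵀ).trace := by
  simpa using (posSemidef_self_mul_conjTranspose A).trace_nonneg

theorem frobNorm_sq {k : ℕ} (A : Matrix (Fin k) (Fin k) ℝ) :
    frobNorm A ^ 2 = (A * Aᵀ).trace :=
  Real.sq_sqrt (trace_mul_transpose_self_nonneg A)

theorem frobNorm_add_transpose_sq {k : ℕ} (A : Matrix (Fin k) (Fin k) ℝ) :
    frobNorm (A + Aᵀ) ^ 2 = 2 * frobNorm A ^ 2 + 2 * (A * A).trace := by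
  have h : (Aᵀ * Aᵀ).trace = (A * A).trace := by
    rw [← transpose_mul, trace_transpose]
  rw [frobNorm_sq, frobNorm_sq, transpose_add, transpose_transpose, add_mul, mul_add, mul_add,
    trace_add, trace_add, trace_add, h, trace_mul_comm Aᵀ A]
  ring

open scoped MatrixOrder in
/-- For `P` positive semidefinite and `S` symmetric, writing `P = BᵀB` gives
`tr((PS)²) = ‖BSBᵀ‖_F² ≥ 0`. -/
theorem trace_mul_mul_self_nonneg {k : ℕ} {P S : Matrix (Fin k) (Fin k) ℝ}
    (hP : P.PosSemidef) (hS : S.IsSymm) : 0 ≤ (P * S * (P * S)).trace := by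
  obtain ⟨B, rfl⟩ := CStarAlgebra.nonneg_iff_eq_star_mul_self.mp hP.nonneg
  have h := trace_mul_transpose_self_nonneg (B * S * Bᵀ)
  rw [transpose_mul, transpose_mul, transpose_transpose, hS.eq] at h
  rw [star_eq_conjTranspose, conjTranspose_eq_transpose_of_trivial]
  simp only [Matrix.mul_assoc] at h ⊢
  rw [trace_mul_comm Bᵀ]
  simpa only [Matrix.mul_assoc] using h

/-- If `W` is a symmetric positive definite real `k×k` matrix and `S`
is a symmetric real `k×k` matrix, then `2‖W⁻¹S‖_F² ≤ ‖W⁻¹S + SW⁻¹‖_F²`. -/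
theorem stmt3 (k : ℕ) (W S : Matrix (Fin k) (Fin k) ℝ)
    (hW : W.PosDef) (hWsymm : W.IsSymm) (hSsymm : S.IsSymm) :
    2 * frobNorm (W⁻¹ * S) ^ 2 ≤ frobNorm (W⁻¹ * S + S * W⁻¹) ^ 2 := by
  have hT : S * W⁻¹ = (W⁻¹ * S)ᵀ := by
    rw [transpose_mul, transpose_nonsing_inv, hWsymm.eq, hSsymm.eq]
  rw [hT, frobNorm_add_transpose_sq]
  linarith [trace_mul_mul_self_nonneg hW.inv.posSemidef hSsymm]
end

section
/- Let W be a symmetric positive definite real k×k matrix and let S be a symmetric real k×k matrix. Then ‖W⁻¹S − S W⁻¹‖_F ≤ ‖W⁻¹S + S W⁻¹‖_F, where ‖·‖_F denotes the Frobenius norm. -/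
open Matrix

open scoped MatrixOrder Matrix.Norms.L2Operator in
/-- For `P` positive semidefinite and `S` symmetric, `tr (P S P S)` is nonnegative. -/
theorem Matrix.PosSemidef.trace_mul_mul_mul_nonneg {n : Type*} [Fintype n]
    {P S : Matrix n n ℝ} (hP : P.PosSemidef) (hS : S.IsSymm) :
    0 ≤ (P * S * (P * S)).trace := by
  classical
  obtain ⟨B, rfl⟩ := CStarAlgebra.nonneg_iff_eq_star_mul_self.mp hP.nonneg
  simp only [star_eq_conjTranspose]
  have h : (Bᴴ * B * S * (Bᴴ * B * S)).trace = ((B * S * Bᴴ) * (B * S * Bᴴ)ᴴ).trace := by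
    have hS' : Sᴴ = S := by rw [conjTranspose_eq_transpose_of_trivial, hS.eq]
    rw [show Bᴴ * B * S * (Bᴴ * B * S) = Bᴴ * (B * S * Bᴴ * B * S) by
      simp only [Matrix.mul_assoc], trace_mul_comm]
    simp only [conjTranspose_mul, conjTranspose_conjTranspose, hS', Matrix.mul_assoc]
  rw [h]
  exact (posSemidef_self_mul_conjTranspose _).trace_nonneg

/-- If `W` is a symmetric positive definite real `k×k` matrix and `S`
is a symmetric real `k×k` matrix, then `‖W⁻¹S − SW⁻¹‖_F ≤ ‖W⁻¹S + SW⁻¹‖_F`. -/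
theorem stmt4 (k : ℕ) (W S : Matrix (Fin k) (Fin k) ℝ)
    (hW : W.PosDef) (hWsymm : W.IsSymm) (hSsymm : S.IsSymm) :
    frobNorm (W⁻¹ * S - S * W⁻¹) ≤ frobNorm (W⁻¹ * S + S * W⁻¹) := by
  have hP : W⁻¹ᵀ = W⁻¹ := by rw [transpose_nonsing_inv, hWsymm.eq]
  have key := hW.inv.posSemidef.trace_mul_mul_mul_nonneg hSsymm
  have hcomm : (S * W⁻¹ * (S * W⁻¹)).trace = (W⁻¹ * S * (W⁻¹ * S)).trace := by
    rw [Matrix.mul_assoc S W⁻¹ (S * W⁻¹), trace_mul_comm S]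
    simp only [Matrix.mul_assoc]
  refine Real.sqrt_le_sqrt ?_
  simp only [transpose_sub, transpose_add, transpose_mul, hP, hSsymm.eq, sub_mul, mul_sub,
    add_mul, mul_add, trace_sub, trace_add]
  linarith
end
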